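/- Let F : ℝ^d → ℝ be C² with L-Lipschitz-continuous Hessian, and suppose the global minimizer s* of the cubic model m(s) = ⟨g,s⟩ + ½⟨s,Hs⟩ + (σ/3)‖s‖³ at point x satisfies the optimality conditions g + H s* + σ‖s*‖ s* = 0 and H + σ‖s*‖ I ⪰ 0, where ‖g − ∇F(x)‖ ≤ δ_g and ‖H − ∇²F(x)‖ ≤ δ_H. Then ‖∇F(x + s*)‖ ≤ (L + σ + ½)‖s*‖² + δ_g + δ_H²/2. -/

import Mathlib

open scoped RealInnerProductSpace

/-- The gradient of a `C²` function is differentiable. -/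
theorem ContDiff.differentiable_gradient {E : Type*} [NormedAddCommGroup E]
    [InnerProductSpace ℝ E] [CompleteSpace E] {f : E → ℝ} (hf : ContDiff ℝ 2 f) :
    Differentiable ℝ (gradient f) :=
  (InnerProductSpace.toDual ℝ E).symm.toContinuousLinearEquiv.differentiable.comp
    ((hf.fderiv_right (m := 1) (by norm_num)).differentiable (by norm_num))

/-- First-order Taylor bound for a map with Lipschitz derivative. -/
theorem norm_sub_sub_fderiv_le_of_lipschitz {E G : Type*} [NormedAddCommGroup E]
    [NormedSpace ℝ E] [NormedAddCommGroup G] [NormedSpace ℝ G] {f : E → G} {L : ℝ}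
    (hL : 0 ≤ L) (hf : Differentiable ℝ f)
    (hLip : ∀ y z, ‖fderiv ℝ f y - fderiv ℝ f z‖ ≤ L * ‖y - z‖) (x s : E) :
    ‖f (x + s) - f x - fderiv ℝ f x s‖ ≤ L * ‖s‖ ^ 2 := by
  have hbound : ∀ y ∈ Metric.closedBall x ‖s‖, ‖fderiv ℝ f y - fderiv ℝ f x‖ ≤ L * ‖s‖ := by
    intro y hy
    rw [mem_closedBall_iff_norm] at hy
    exact (hLip y x).trans (by gcongr)
  have h := (convex_closedBall x ‖s‖).norm_image_sub_le_of_norm_fderiv_le'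
    (fun y _ => hf y) hbound (Metric.mem_closedBall_self (norm_nonneg s))
    (show x + s ∈ Metric.closedBall x ‖s‖ by simp)
  rwa [add_sub_cancel_left, mul_assoc, ← sq] at h

/-- Gradient bound at the global minimizer of the cubic subproblem:
`‖∇F(x+s*)‖ ≤ (L + σ + ½)‖s*‖² + δ_g + δ_H²/2`. -/
theorem cubic_minimizer_gradient_bound
    {d : ℕ} (F : EuclideanSpace ℝ (Fin d) → ℝ)
    (x g sStar : EuclideanSpace ℝ (Fin d))
    (H : EuclideanSpace ℝ (Fin d) →L[ℝ] EuclideanSpace ℝ (Fin d))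
    (L σ δg δH : ℝ) (hL : 0 < L) (hσ : 0 < σ) (hδg : 0 ≤ δg) (hδH : 0 ≤ δH)
    (hF : ContDiff ℝ 2 F)
    (hHsym : ∀ u v, ⟪H u, v⟫ = ⟪u, H v⟫)
    (hLip : ∀ y z : EuclideanSpace ℝ (Fin d),
      ‖fderiv ℝ (gradient F) y - fderiv ℝ (gradient F) z‖ ≤ L * ‖y - z‖)
    (hg : ‖g - gradient F x‖ ≤ δg)
    (hH : ‖H - fderiv ℝ (gradient F) x‖ ≤ δH)
    (hfoc : g + H sStar + (σ * ‖sStar‖) • sStar = 0)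
    (hsoc : ∀ v : EuclideanSpace ℝ (Fin d),
      0 ≤ ⟪v, H v⟫ + σ * ‖sStar‖ * ‖v‖^2) :
    ‖gradient F (x + sStar)‖ ≤ (L + σ + 1/2) * ‖sStar‖^2 + δg + δH^2/2 := by
  have hTaylor := norm_sub_sub_fderiv_le_of_lipschitz hL.le hF.differentiable_gradient hLip x sStar
  have hHs : ‖(H - fderiv ℝ (gradient F) x) sStar‖ ≤ δH * ‖sStar‖ :=
    ContinuousLinearMap.le_of_opNorm_le _ hH _
  have hmodel : ‖(σ * ‖sStar‖) • sStar‖ = σ * ‖sStar‖ ^ 2 := by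
    rw [norm_smul, Real.norm_of_nonneg (by positivity)]
    ring
  have hdecomp : gradient F (x + sStar) =
      (gradient F (x + sStar) - gradient F x - fderiv ℝ (gradient F) x sStar)
        - (g - gradient F x) - (H - fderiv ℝ (gradient F) x) sStar
        - (σ * ‖sStar‖) • sStar := by
    rw [← sub_eq_zero, ← hfoc, sub_apply]
    abel
  rw [hdecomp]
  refine (norm_sub_le_of_le (norm_sub_le_of_le (norm_sub_le_of_le hTaylor hg) hHs)
    hmodel.le).trans ?_
  nlinarith [sq_nonneg (δH - ‖sStar‖)]
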